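/- arXiv:2509.25629 — 4 statements merged into one kernel-verified Lean document; each statement's English description precedes it below -/
import Mathlib

section
/- Let n ≥ 1, let 0 ≤ α_1 < α_2 < … < α_n < 1 and 0 ≤ β_1 < β_2 < … < β_n < 1 be real numbers with α_j ≠ β_k for all j, k, and set a_j = exp(2πi·α_j) and b_j = exp(2πi·β_j). Let (A, B) be a hypergeometric pair with parameters (a_1,…,a_n; b_1,…,b_n). Then there exists an invertible matrix M ∈ GL_n(ℂ) such that M·A·M⁻¹ and M·B·M⁻¹ are both unitary matrices if and only if the exponents interlace, i.e. either α_1 < β_1 < α_2 < β_2 < … < α_n < β_n or β_1 < α_1 < β_2 < α_2 < … < β_n < α_n. -/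
open Matrix Polynomial Complex

/-- Two increasing `n`-tuples of reals interlace (first one starting). -/
def Interlaces {n : ℕ} (x y : Fin n → ℝ) : Prop :=
  (∀ i, x i < y i) ∧ ∀ i : Fin n, ∀ h : (i : ℕ) + 1 < n, y i < x ⟨(i : ℕ) + 1, h⟩

theorem Matrix.exists_eq_vecMulVec_of_rank_le_one {K m n : Type*} [Field K] [Fintype m] [Fintype n]
    [DecidableEq n] (N : Matrix m n K) (h : N.rank ≤ 1) :
    ∃ (u : m → K) (v : n → K), N = vecMulVec u v := by
  obtain ⟨u, hu⟩ := finrank_le_one_iff.mp (show Module.finrank K N.mulVecLin.range ≤ 1 from h)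
  choose c hc using fun j => hu ⟨N.mulVecLin (Pi.single j 1), LinearMap.mem_range_self _ _⟩
  refine ⟨u, c, ?_⟩
  ext i j
  have := congrFun (congrArg Subtype.val (hc j)) i
  simp [vecMulVec_apply] at this ⊢
  rw [← this, mul_comm]

theorem Matrix.exists_eq_conj_diagonal {K n : Type*} [Field K] [Fintype n] [DecidableEq n]
    (A : Matrix n n K) (a : n → K) (ha : Function.Injective a)
    (hA : A.charpoly = ∏ j, (X - C (a j))) :
    ∃ P : GL n K, A = (P : Matrix n n K) * diagonal a * ((P⁻¹ : GL n K) : Matrix n n K) := by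
  have hev : ∀ j, Module.End.HasEigenvalue A.toLin' (a j) := by
    intro j
    rw [Module.End.hasEigenvalue_iff_isRoot_charpoly, Matrix.charpoly_toLin', hA, IsRoot.def,
      eval_prod]
    exact Finset.prod_eq_zero (Finset.mem_univ j) (by simp)
  choose x hx using fun j => (hev j).exists_hasEigenvector
  have hli := Module.End.eigenvectors_linearIndependent' A.toLin' a ha x hx
  have hu : IsUnit (Matrix.of fun i j => x j i) := by
    rw [← Matrix.linearIndependent_cols_iff_isUnit]
    exact hli
  refine ⟨hu.unit, ?_⟩
  rw [Units.eq_mul_inv_iff_mul_eq]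
  ext i j
  have := congrFun (hx j).apply_eq_smul i
  simp only [toLin'_apply, mulVec, dotProduct, Pi.smul_apply, smul_eq_mul] at this
  simp [mul_apply, diagonal_apply, this, mul_comm]

theorem Matrix.prod_sub_roots_charpoly_diagonal_mul_one_add_vecMulVec {K n : Type*} [Field K]
    [Infinite K] [Fintype n] [DecidableEq n] (a b u v : n → K)
    (h : (diagonal a * (1 + vecMulVec u v)).charpoly = ∏ j, (X - C (b j))) (j : n) :
    ∏ k, (a j - b k) = -(a j * (u j * v j)) * ∏ i ∈ Finset.univ.erase j, (a j - a i) := by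
  have key : ∏ k, (X - C (b k)) =
      ∏ k, (X - C (a k)) - ∑ i, C (a i * (u i * v i)) * ∏ k ∈ Finset.univ.erase i, (X - C (a k)) := by
    apply eq_of_infinite_eval_eq
    refine ((Set.finite_range a).infinite_compl).mono ?_
    intro t ht
    have hne : ∀ i, t - a i ≠ 0 := fun i hi => ht ⟨i, (sub_eq_zero.mp hi).symm⟩
    have hdet : IsUnit (diagonal fun i => t - a i).det := by
      rw [det_diagonal]
      exact (Finset.prod_ne_zero_iff.mpr fun i _ => hne i).isUnit
    have hmat : scalar n t - diagonal a * (1 + vecMulVec u v) =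
        (diagonal fun i => t - a i) +
          replicateCol Unit (fun i => -(a i * u i)) * replicateRow Unit v := by
      ext i k
      by_cases hik : i = k <;>
        simp [hik, mul_apply, diagonal_apply, vecMulVec_apply, one_apply] <;> ring
    have hinv : (diagonal fun i => t - a i)⁻¹ = diagonal fun i => (t - a i)⁻¹ := by
      apply inv_eq_left_inv
      simp [hne, diagonal_mul_diagonal]
    show eval t _ = eval t _
    rw [← h, eval_charpoly, hmat, det_add_replicateCol_mul_replicateRow hdet, hinv]
    simp only [det_unique, det_diagonal, eval_sub, eval_prod, eval_X, eval_C, eval_finsetSum,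
      eval_mul]
    simp only [add_apply, one_apply_eq, mul_apply, replicateRow_apply, replicateCol_apply,
      diagonal_apply, mul_ite, mul_zero, Finset.sum_ite_eq', Finset.mem_univ, if_true]
    rw [mul_add, mul_one, sub_eq_add_neg, Finset.mul_sum, ← Finset.sum_neg_distrib]
    congr 1
    refine Finset.sum_congr rfl fun i _ => ?_
    rw [← Finset.mul_prod_erase _ _ (Finset.mem_univ i)]
    field_simp [hne i]
  have := congrArg (eval (a j)) key
  simp only [eval_sub, eval_prod, eval_X, eval_C, eval_finsetSum, eval_mul] at this
  rw [this, Finset.prod_eq_zero (Finset.mem_univ j) (sub_self _),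
    Finset.sum_eq_single j, zero_sub, neg_mul]
  · intro i _ hij
    rw [Finset.prod_eq_zero (Finset.mem_erase.mpr ⟨hij.symm, Finset.mem_univ j⟩) (sub_self _),
      mul_zero]
  · simp

theorem Finset.neg_one_pow_card_filter_neg_mul_prod_pos {ι R : Type*} [CommRing R] [LinearOrder R]
    [IsStrictOrderedRing R] (s : Finset ι) (f : ι → R) (hf : ∀ i ∈ s, f i ≠ 0) :
    0 < (-1) ^ (s.filter fun i => f i < 0).card * ∏ i ∈ s, f i := by
  rw [Finset.card_filter, ← Finset.prod_pow_eq_pow_sum, ← Finset.prod_mul_distrib]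
  refine Finset.prod_pos fun i hi => ?_
  rcases lt_or_gt_of_ne (hf i hi) with h | h
  · simp [h]
  · simp [h, h.not_gt]

theorem interlaces_or_interlaces_iff_even {n : ℕ} (hn : 1 ≤ n) {α β : Fin n → ℝ}
    (hα : StrictMono α) (hβ : StrictMono β) (hαβ : ∀ j k, α j ≠ β k) :
    (∀ i j : Fin n, Even ((Finset.univ.filter fun k => β k < α i).card + i +
        ((Finset.univ.filter fun k => β k < α j).card + j))) ↔
      (Interlaces α β ∨ Interlaces β α) := by
  obtain ⟨m, hm⟩ : ∃ m : Fin n → ℕ, ∀ i, (Finset.univ.filter fun k => β k < α i).card = m i :=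
    ⟨_, fun _ => rfl⟩
  have hlt : ∀ i k : Fin n, (k : ℕ) < m i ↔ β k < α i := by
    intro i k
    rw [← hm]
    refine ⟨fun h => ?_, fun h => ?_⟩
    · by_contra hk
      have : (Finset.univ.filter fun k => β k < α i) ⊆ Finset.Iio k := by
        intro l hl
        simp only [Finset.mem_filter, Finset.mem_univ, true_and] at hl
        exact Finset.mem_Iio.mpr (hβ.lt_iff_lt.mp (hl.trans_le (not_lt.mp hk)))
      have := Finset.card_le_card this
      rw [Fin.card_Iio] at this
      omega
    · have : Finset.Iic k ⊆ (Finset.univ.filter fun k => β k < α i) := by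
        intro l hl
        simp only [Finset.mem_filter, Finset.mem_univ, true_and]
        exact (hβ.monotone (Finset.mem_Iic.mp hl)).trans_lt h
      have := Finset.card_le_card this
      rw [Fin.card_Iic] at this
      omega
  have hgt : ∀ i k : Fin n, m i ≤ k ↔ α i < β k := by
    intro i k
    rw [← not_lt, hlt, not_lt]
    exact ⟨fun h => lt_of_le_of_ne h (hαβ i k), le_of_lt⟩
  have hmn : ∀ i, m i ≤ n := fun i => by
    rw [← hm]; exact (Finset.card_le_univ _).trans_eq (Fintype.card_fin n)
  have hα' : ∀ i : Fin n, ∀ h : (i : ℕ) + 1 < n, α i < α ⟨i + 1, h⟩ :=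
    fun i h => hα (Fin.mk_lt_mk.mpr (Nat.lt_succ_self _))
  simp only [hm]
  constructor
  · intro hpar
    have hstep : ∀ i : Fin n, ∀ h : (i : ℕ) + 1 < n, m i + 1 ≤ m ⟨i + 1, h⟩ := by
      intro i h
      have hle : m i ≤ m ⟨i + 1, h⟩ := by
        rw [← hm, ← hm]
        refine Finset.card_le_card fun l hl => ?_
        simp only [Finset.mem_filter, Finset.mem_univ, true_and] at hl ⊢
        exact hl.trans (hα' i h)
      have := hpar i ⟨i + 1, h⟩
      simp only [Nat.even_iff] at this
      omega
    have hdiff : ∀ d : ℕ, ∀ i : Fin n, ∀ h : (i : ℕ) + d < n, m i + d ≤ m ⟨i + d, h⟩ := by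
      intro d
      induction d with
      | zero => intro i h; simp
      | succ d ih =>
        intro i h
        have h1 := ih i (by omega)
        have h2 := hstep ⟨i + d, by omega⟩ (by simp only; omega)
        simp only [add_assoc] at h2
        omega
    have hlow : ∀ i : Fin n, m ⟨0, hn⟩ + i ≤ m i := by
      intro i
      have := hdiff i ⟨0, hn⟩ (by simp)
      simpa using this
    have hup : ∀ i : Fin n, m i ≤ i + 1 := by
      intro i
      have h1 := hdiff (n - 1 - i) i (by omega)
      have h2 := hmn ⟨i + (n - 1 - i), by omega⟩
      omega
    have hpar0 : ∀ i : Fin n, m i = m ⟨0, hn⟩ + i := by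
      intro i
      have h1 := hpar i ⟨0, hn⟩
      have h2 := hlow i
      have h3 := hup i
      simp only [Nat.even_iff] at h1
      omega
    have h01 := hup ⟨0, hn⟩
    simp only at h01
    rcases Nat.eq_zero_or_pos (m ⟨0, hn⟩) with h0 | h0
    · left
      refine ⟨fun i => (hgt _ _).mp ?_, fun i h => (hlt _ _).mp ?_⟩
      · have := hpar0 i; omega
      · have := hpar0 ⟨i + 1, h⟩; simp only at this; omega
    · right
      refine ⟨fun i => (hlt _ _).mp ?_, fun i h => (hgt _ _).mp ?_⟩
      · have := hpar0 i; omega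
      · have := hpar0 i; simp only; omega
  · rintro (⟨h1, h2⟩ | ⟨h1, h2⟩)
    · have : ∀ i, m i = i := by
        intro i
        refine le_antisymm ((hgt _ _).mpr (h1 i)) ?_
        rcases Nat.eq_zero_or_pos (i : ℕ) with h0 | h0
        · omega
        · have := (hlt i ⟨i - 1, by omega⟩).mpr (by
            convert h2 ⟨i - 1, by omega⟩ (by simp only; omega) using 2
            ext; simp only; omega)
          simp only at this
          omega
      intro i j
      simp [this, Nat.even_iff]; omega
    · have : ∀ i, m i = i + 1 := by
        intro i
        refine le_antisymm ?_ ((hlt _ _).mpr (h1 i))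
        by_cases h : (i : ℕ) + 1 < n
        · exact (hgt i ⟨i + 1, h⟩).mpr (h2 i h)
        · have := hmn i; omega
      intro i j
      simp [this, Nat.even_iff]; omega

theorem Complex.exp_two_pi_mul_I_sub_exp (x y : ℝ) :
    exp (2 * Real.pi * I * x) - exp (2 * Real.pi * I * y) =
      2 * I * exp (Real.pi * I * x) * exp (Real.pi * I * y) * (Real.sin (Real.pi * (x - y)) : ℝ) := by
  have h1 : exp (2 * Real.pi * I * x) = exp (Real.pi * I * x) ^ 2 := by
    rw [← Complex.exp_nat_mul]; congr 1; push_cast; ring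
  have h2 : exp (2 * Real.pi * I * y) = exp (Real.pi * I * y) ^ 2 := by
    rw [← Complex.exp_nat_mul]; congr 1; push_cast; ring
  have h3 : exp ((Real.pi * (x - y) : ℂ) * I) = exp (Real.pi * I * x) / exp (Real.pi * I * y) := by
    rw [← Complex.exp_sub]; congr 1; ring
  have h4 : exp (-(Real.pi * (x - y) : ℂ) * I) = exp (Real.pi * I * y) / exp (Real.pi * I * x) := by
    rw [← Complex.exp_sub]; congr 1; ring
  push_cast
  rw [Complex.sin, h3, h4, h1, h2]
  have e1 := Complex.exp_ne_zero (Real.pi * I * x)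
  have e2 := Complex.exp_ne_zero (Real.pi * I * y)
  field_simp
  linear_combination ((exp (Real.pi * I * x)) ^ 2 - exp (Real.pi * I * y) ^ 2) * Complex.I_sq

theorem Real.sin_pi_mul_neg_iff {x : ℝ} (h1 : -1 < x) (h2 : x < 1) :
    Real.sin (Real.pi * x) < 0 ↔ x < 0 := by
  have hpi := Real.pi_pos
  refine ⟨fun h => ?_, fun h => Real.sin_neg_of_neg_of_neg_pi_lt (by nlinarith) (by nlinarith)⟩
  by_contra hx
  exact absurd (Real.sin_nonneg_of_nonneg_of_le_pi (x := Real.pi * x) (by nlinarith) (by nlinarith))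
    (not_le.mpr h)

theorem Real.sin_pi_mul_ne_zero {x : ℝ} (h1 : -1 < x) (h2 : x < 1) (h : x ≠ 0) :
    Real.sin (Real.pi * x) ≠ 0 := by
  have hpi := Real.pi_pos
  rw [Ne, Real.sin_eq_zero_iff_of_lt_of_lt (by nlinarith) (by nlinarith)]
  exact mul_ne_zero hpi.ne' h

/-- Up to a factor independent of `j`, the residue at `exp (2πi α j)` of
`∏ k, (t - exp (2πi β k)) / (t - exp (2πi α k))` divided by the location of the pole. -/
noncomputable def residueRatio {n : ℕ} (α β : Fin n → ℝ) (j : Fin n) : ℝ :=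
  (∏ k, Real.sin (Real.pi * (α j - β k))) /
    ∏ i ∈ Finset.univ.erase j, Real.sin (Real.pi * (α j - α i))

section
variable {n : ℕ} {α β : Fin n → ℝ}

theorem prod_sin_ne_zero {γ : Fin n → ℝ}
    (hα0 : ∀ i, 0 ≤ α i) (hα1 : ∀ i, α i < 1) (hγ0 : ∀ i, 0 ≤ γ i) (hγ1 : ∀ i, γ i < 1)
    (j : Fin n) (s : Finset (Fin n)) (h : ∀ k ∈ s, α j ≠ γ k) :
    ∏ k ∈ s, Real.sin (Real.pi * (α j - γ k)) ≠ 0 :=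
  Finset.prod_ne_zero_iff.mpr fun k hk => Real.sin_pi_mul_ne_zero
    (by linarith [hα0 j, hγ1 k]) (by linarith [hα1 j, hγ0 k]) (sub_ne_zero.mpr (h k hk))

theorem neg_one_pow_mul_prod_sin_pos {γ : Fin n → ℝ}
    (hα0 : ∀ i, 0 ≤ α i) (hα1 : ∀ i, α i < 1) (hγ0 : ∀ i, 0 ≤ γ i) (hγ1 : ∀ i, γ i < 1)
    (j : Fin n) (s : Finset (Fin n)) (h : ∀ k ∈ s, α j ≠ γ k) :
    0 < (-1 : ℝ) ^ (s.filter fun k => α j < γ k).card *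
      ∏ k ∈ s, Real.sin (Real.pi * (α j - γ k)) := by
  have := Finset.neg_one_pow_card_filter_neg_mul_prod_pos s
    (fun k => Real.sin (Real.pi * (α j - γ k))) fun k hk => Real.sin_pi_mul_ne_zero
      (by linarith [hα0 j, hγ1 k]) (by linarith [hα1 j, hγ0 k]) (sub_ne_zero.mpr (h k hk))
  rwa [Finset.filter_congr fun k _ => (Real.sin_pi_mul_neg_iff (by linarith [hα0 j, hγ1 k])
    (by linarith [hα1 j, hγ0 k])).trans sub_neg] at this

theorem exists_mul_residueRatio (hα : Function.Injective α)
    (hα0 : ∀ i, 0 ≤ α i) (hα1 : ∀ i, α i < 1)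
    (a b w : Fin n → ℂ)
    (ha : ∀ j, a j = exp (2 * Real.pi * I * (α j : ℂ)))
    (hb : ∀ j, b j = exp (2 * Real.pi * I * (β j : ℂ)))
    (hw : ∀ j, ∏ k, (a j - b k) = -(a j * w j) * ∏ i ∈ Finset.univ.erase j, (a j - a i)) :
    ∃ c : ℂ, c ≠ 0 ∧ ∀ j, w j = c * residueRatio α β j := by
  have hEa : ∏ k, exp (Real.pi * I * α k) ≠ 0 :=
    Finset.prod_ne_zero_iff.mpr fun _ _ => exp_ne_zero _
  have hEb : ∏ k, exp (Real.pi * I * β k) ≠ 0 :=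
    Finset.prod_ne_zero_iff.mpr fun _ _ => exp_ne_zero _
  refine ⟨-(2 * I) * (∏ k, exp (Real.pi * I * β k)) / ∏ k, exp (Real.pi * I * α k), ?_, ?_⟩
  · exact div_ne_zero (mul_ne_zero (by simp) hEb) hEa
  intro j
  have hQ : ∏ i ∈ Finset.univ.erase j, Real.sin (Real.pi * (α j - α i)) ≠ 0 :=
    prod_sin_ne_zero hα0 hα1 hα0 hα1 j _ fun k hk h => (Finset.mem_erase.mp hk).1 (hα h).symm
  have hj := hw j
  have haj : a j = exp (Real.pi * I * α j) ^ 2 := by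
    rw [ha, ← Complex.exp_nat_mul]; congr 1; push_cast; ring
  have hP : ∏ k, (a j - b k) = (2 * I * exp (Real.pi * I * α j)) ^ n *
      (∏ k, exp (Real.pi * I * β k)) * ((∏ k, Real.sin (Real.pi * (α j - β k)) : ℝ) : ℂ) := by
    simp only [ha, hb, exp_two_pi_mul_I_sub_exp, Finset.prod_mul_distrib, Finset.prod_const,
      Finset.card_univ, Fintype.card_fin, ofReal_prod, mul_pow]
  have hR : 2 * I * a j * ∏ i ∈ Finset.univ.erase j, (a j - a i) =
      (2 * I * exp (Real.pi * I * α j)) ^ n * (∏ k, exp (Real.pi * I * α k)) *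
        ((∏ i ∈ Finset.univ.erase j, Real.sin (Real.pi * (α j - α i)) : ℝ) : ℂ) := by
    have : (2 * I * exp (Real.pi * I * α j)) ^ n * (∏ k, exp (Real.pi * I * α k)) =
        ∏ k, (2 * I * exp (Real.pi * I * α j) * exp (Real.pi * I * α k)) := by
      simp [Finset.prod_mul_distrib]
    have hfac : ∏ i ∈ Finset.univ.erase j, (a j - a i) = (∏ i ∈ Finset.univ.erase j,
        (2 * I * exp (Real.pi * I * α j) * exp (Real.pi * I * α i))) *
        ∏ i ∈ Finset.univ.erase j, ((Real.sin (Real.pi * (α j - α i)) : ℝ) : ℂ) := by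
      simp only [ha, exp_two_pi_mul_I_sub_exp, Finset.prod_mul_distrib]
    rw [this, ← Finset.mul_prod_erase _ _ (Finset.mem_univ j), hfac, haj, ofReal_prod]
    ring
  have hE : (2 * I * exp (Real.pi * I * α j)) ^ n ≠ 0 := pow_ne_zero _ (by simp)
  have hQ' : ((∏ i ∈ Finset.univ.erase j, Real.sin (Real.pi * (α j - α i)) : ℝ) : ℂ) ≠ 0 :=
    ofReal_ne_zero.mpr hQ
  rw [hP] at hj
  rw [residueRatio, ofReal_div, div_mul_div_comm, eq_div_iff (mul_ne_zero hEa hQ')]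
  apply mul_left_cancel₀ hE
  linear_combination (2 * I) * hj - w j * hR

theorem residueRatio_mul_pos_iff (hα : StrictMono α)
    (hα0 : ∀ i, 0 ≤ α i) (hα1 : ∀ i, α i < 1) (hβ0 : ∀ i, 0 ≤ β i) (hβ1 : ∀ i, β i < 1)
    (hαβ : ∀ j k, α j ≠ β k) (i j : Fin n) :
    0 < residueRatio α β i * residueRatio α β j ↔
      Even ((Finset.univ.filter fun k => β k < α i).card + i +
        ((Finset.univ.filter fun k => β k < α j).card + j)) := by
  have key : ∀ j : Fin n, 0 < (-1) ^ ((Finset.univ.filter fun k => β k < α j).card + j + 1) *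
      residueRatio α β j := by
    intro j
    have hP := neg_one_pow_mul_prod_sin_pos hα0 hα1 hβ0 hβ1 j Finset.univ fun k _ => hαβ j k
    have hQ := neg_one_pow_mul_prod_sin_pos hα0 hα1 hα0 hα1 j (Finset.univ.erase j)
      fun k hk h => (Finset.mem_erase.mp hk).1 (hα.injective h).symm
    have h1 : (Finset.univ.filter fun k => β k < α j).card +
        (Finset.univ.filter fun k => α j < β k).card = n := by
      have := Finset.card_filter_add_card_filter_not (s := Finset.univ) (fun k => β k < α j)
      rw [Finset.card_univ, Fintype.card_fin] at this
      convert this using 4 with k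
      rw [not_lt]
      exact ⟨le_of_lt, fun h => lt_of_le_of_ne h (hαβ j k)⟩
    have h2 : ((Finset.univ.erase j).filter fun k => α j < α k).card = n - 1 - j := by
      rw [← Fin.card_Ioi]
      congr 1
      ext k
      simp only [Finset.mem_filter, Finset.mem_erase, Finset.mem_univ, and_true, Finset.mem_Ioi,
        hα.lt_iff_lt]
      exact ⟨fun h => h.2, fun h => ⟨h.ne', h⟩⟩
    have h3 := div_pos hP hQ
    rw [mul_div_mul_comm] at h3
    have h4 : (-1 : ℝ) ^ ((Finset.univ.filter fun k => β k < α j).card + j + 1) =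
        (-1) ^ (Finset.univ.filter fun k => α j < β k).card /
          (-1) ^ ((Finset.univ.erase j).filter fun k => α j < α k).card := by
      rw [eq_div_iff (pow_ne_zero _ (by norm_num)), ← pow_add]
      apply neg_one_pow_congr
      rw [Nat.even_iff, Nat.even_iff]
      omega
    rw [h4]
    exact h3
  have h := mul_pos (key i) (key j)
  rw [mul_mul_mul_comm, ← pow_add] at h
  set x := residueRatio α β i * residueRatio α β j
  rcases Nat.even_or_odd ((Finset.univ.filter fun k => β k < α i).card + i +
        ((Finset.univ.filter fun k => β k < α j).card + j)) with he | ho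
  · rw [Even.neg_one_pow (by rw [Nat.even_iff] at he ⊢; omega), one_mul] at h
    exact iff_of_true h he
  · rw [Odd.neg_one_pow (by rw [Nat.odd_iff] at ho ⊢; omega)] at h
    exact iff_of_false (by linarith) (Nat.not_even_iff_odd.mpr ho)

end

theorem Matrix.conj_mem_unitaryGroup_iff {ι : Type*} [Fintype ι] [DecidableEq ι] (M : GL ι ℂ)
    (N : Matrix ι ι ℂ) :
    (M : Matrix ι ι ℂ) * N * ((M⁻¹ : GL ι ℂ) : Matrix ι ι ℂ) ∈ unitaryGroup ι ℂ ↔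
      Nᴴ * ((M : Matrix ι ι ℂ)ᴴ * (M : Matrix ι ι ℂ)) * N =
        (M : Matrix ι ι ℂ)ᴴ * (M : Matrix ι ι ℂ) := by
  have h1 : ((M⁻¹ : GL ι ℂ) : Matrix ι ι ℂ) * (M : Matrix ι ι ℂ) = 1 := M.inv_mul
  have h2 : (M : Matrix ι ι ℂ) * ((M⁻¹ : GL ι ℂ) : Matrix ι ι ℂ) = 1 := M.mul_inv
  generalize (M : Matrix ι ι ℂ) = P at *
  generalize ((M⁻¹ : GL ι ℂ) : Matrix ι ι ℂ) = Q at *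
  have h3 : Qᴴ * Pᴴ = 1 := by rw [← conjTranspose_mul, h2, conjTranspose_one]
  have h4 : Pᴴ * Qᴴ = 1 := by rw [← conjTranspose_mul, h1, conjTranspose_one]
  rw [mem_unitaryGroup_iff', star_eq_conjTranspose, conjTranspose_mul, conjTranspose_mul]
  constructor
  · intro h
    calc Nᴴ * (Pᴴ * P) * N = (Pᴴ * Qᴴ) * (Nᴴ * (Pᴴ * P) * N) * (Q * P) := by
          rw [h4, h1, one_mul, mul_one]
      _ = Pᴴ * (Qᴴ * (Nᴴ * Pᴴ) * (P * N * Q)) * P := by noncomm_ring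
      _ = Pᴴ * P := by rw [h, mul_one]
  · intro h
    calc Qᴴ * (Nᴴ * Pᴴ) * (P * N * Q) = Qᴴ * (Nᴴ * (Pᴴ * P) * N) * Q := by noncomm_ring
      _ = (Qᴴ * Pᴴ) * (P * Q) := by rw [h]; noncomm_ring
      _ = 1 := by rw [h3, h2, one_mul]

theorem Complex.conj_mul_self_of_norm_eq_one {z : ℂ} (hz : ‖z‖ = 1) : star z * z = 1 := by
  have := Complex.conj_mul' z
  rw [hz] at this
  simpa using this

open scoped ComplexOrder in
theorem Matrix.exists_unitary_conj_diagonal_iff {ι : Type*} [Fintype ι] [DecidableEq ι]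
    (a : ι → ℂ) (ha : Function.Injective a) (ha1 : ∀ i, ‖a i‖ = 1) (R : Matrix ι ι ℂ) :
    (∃ M : GL ι ℂ, (M : Matrix ι ι ℂ) * diagonal a * ((M⁻¹ : GL ι ℂ) : Matrix ι ι ℂ)
          ∈ unitaryGroup ι ℂ ∧
        (M : Matrix ι ι ℂ) * (diagonal a * R) * ((M⁻¹ : GL ι ℂ) : Matrix ι ι ℂ)
          ∈ unitaryGroup ι ℂ) ↔
      ∃ h : ι → ℝ, (∀ i, 0 < h i) ∧
        Rᴴ * diagonal (fun i => (h i : ℂ)) * R = diagonal fun i => (h i : ℂ) := by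
  have hst : ∀ i, star (a i) * a i = 1 := fun i => conj_mul_self_of_norm_eq_one (ha1 i)
  simp only [conj_mem_unitaryGroup_iff]
  constructor
  · rintro ⟨M, h1, h2⟩
    have hpd : ((M : Matrix ι ι ℂ)ᴴ * (M : Matrix ι ι ℂ)).PosDef :=
      PosDef.conjTranspose_mul_self _ (mulVec_injective_of_isUnit M.isUnit)
    generalize (M : Matrix ι ι ℂ)ᴴ * (M : Matrix ι ι ℂ) = H at *
    have hdiag : H = diagonal fun i => ((H i i).re : ℂ) := by
      ext i j
      by_cases hij : i = j
      · subst hij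
        rw [diagonal_apply_eq]
        have := hpd.isHermitian.apply i i
        exact (Complex.conj_eq_iff_re.mp this).symm
      · rw [diagonal_apply_ne _ hij]
        have := congrFun (congrFun h1 i) j
        rw [diagonal_conjTranspose, mul_diagonal, diagonal_mul] at this
        by_contra hH
        apply hij
        apply ha
        have h3 : star (a i) * a j = 1 := by
          apply mul_left_cancel₀ hH
          rw [mul_one]
          linear_combination this
        have h4 := hst i
        have h5 : star (a i) ≠ 0 := left_ne_zero_of_mul_eq_one h4
        exact mul_left_cancel₀ h5 (h4.trans h3.symm)
    refine ⟨fun i => (H i i).re, fun i => ?_, ?_⟩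
    · exact (Complex.pos_iff.mp (hpd.diag_pos (i := i))).1
    · rw [← hdiag]
      rw [conjTranspose_mul] at h2
      calc Rᴴ * H * R = Rᴴ * ((diagonal a)ᴴ * H * diagonal a) * R := by rw [h1]
        _ = Rᴴ * (diagonal a)ᴴ * H * (diagonal a * R) := by noncomm_ring
        _ = H := h2
  · rintro ⟨h, hpos, hR⟩
    have hu : IsUnit (diagonal fun i => ((Real.sqrt (h i) : ℝ) : ℂ)) := by
      rw [isUnit_diagonal, Pi.isUnit_iff]
      exact fun i => (ofReal_ne_zero.mpr (Real.sqrt_pos.mpr (hpos i)).ne').isUnit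
    have hM : (hu.unit : Matrix ι ι ℂ)ᴴ * (hu.unit : Matrix ι ι ℂ) =
        diagonal fun i => (h i : ℂ) := by
      rw [hu.unit_spec, diagonal_conjTranspose, diagonal_mul_diagonal]
      congr 1
      ext i
      simp [← ofReal_mul, Real.mul_self_sqrt (hpos i).le]
    have hD : (diagonal a)ᴴ * (diagonal fun i => (h i : ℂ)) * diagonal a =
        diagonal fun i => (h i : ℂ) := by
      rw [diagonal_conjTranspose, diagonal_mul_diagonal, diagonal_mul_diagonal]
      congr 1
      ext i
      rw [Pi.star_apply, mul_right_comm, hst, one_mul]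
    refine ⟨hu.unit, ?_, ?_⟩
    · rw [hM, hD]
    · rw [hM, conjTranspose_mul]
      calc _ = Rᴴ * ((diagonal a)ᴴ * (diagonal fun i => (h i : ℂ)) * diagonal a) * R := by
            noncomm_ring
        _ = _ := by rw [hD, hR]

theorem Matrix.conjTranspose_mul_diagonal_mul_eq_iff {ι : Type*} [Fintype ι] [DecidableEq ι]
    (u v : ι → ℂ) (h : ι → ℝ) :
    (1 + vecMulVec u v)ᴴ * diagonal (fun i => (h i : ℂ)) * (1 + vecMulVec u v) =
        diagonal (fun i => (h i : ℂ)) ↔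
      ∀ i j, h i * u i * v j + star (v i) * star (u j) * h j +
        star (v i) * v j * ∑ k, h k * (star (u k) * u k) = 0 := by
  have : ∀ i j, ((1 + vecMulVec u v)ᴴ * diagonal (fun i => (h i : ℂ)) * (1 + vecMulVec u v) :
      Matrix ι ι ℂ) i j =
      diagonal (fun i => (h i : ℂ)) i j + (h i * u i * v j + star (v i) * star (u j) * h j +
        star (v i) * v j * ∑ k, h k * (star (u k) * u k)) := by
    intro i j
    have e1 : (vecMulVec u v)ᴴ = vecMulVec (star v) (star u) := by
      ext i j; simp [vecMulVec_apply, mul_comm]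
    rw [conjTranspose_add, conjTranspose_one, e1, add_mul, one_mul, mul_add, mul_one, add_mul]
    have e2 : (vecMulVec (star v) (star u) * diagonal (fun i => (h i : ℂ)) * vecMulVec u v) i j =
        star (v i) * v j * ∑ k, h k * (star (u k) * u k) := by
      rw [mul_apply, Finset.mul_sum]
      refine Finset.sum_congr rfl fun k _ => ?_
      simp [mul_diagonal, vecMulVec_apply]; ring
    simp only [add_apply, e2, mul_diagonal, diagonal_mul, vecMulVec_apply, Pi.star_apply]
    ring
  constructor
  · intro hh i j
    have h2 := this i j
    rw [hh] at h2
    exact left_eq_add.mp h2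
  · intro hh
    ext i j
    rw [this, hh, add_zero]

theorem exists_pos_diagonal_invariant_iff {ι : Type*} [Fintype ι] [DecidableEq ι] [Nonempty ι]
    (u v : ι → ℂ) (c : ℂ) (hc : c ≠ 0) (S : ι → ℝ) (hS : ∀ j, S j ≠ 0)
    (huv : ∀ j, u j * v j = c * S j) (hdet : ‖1 + ∑ k, u k * v k‖ = 1) :
    (∃ h : ι → ℝ, (∀ i, 0 < h i) ∧ (1 + vecMulVec u v)ᴴ * diagonal (fun i => (h i : ℂ)) *
        (1 + vecMulVec u v) = diagonal (fun i => (h i : ℂ))) ↔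
      ∀ i j, 0 < S i * S j := by
  have huv0 : ∀ j, u j * v j ≠ 0 := fun j => by
    rw [huv]; exact mul_ne_zero hc (ofReal_ne_zero.mpr (hS j))
  have hv : ∀ j, v j ≠ 0 := fun j => right_ne_zero_of_mul (huv0 j)
  have hN : ∀ j, star (v j) * v j = (Complex.normSq (v j) : ℂ) :=
    fun j => Complex.normSq_eq_conj_mul_self.symm
  have hNpos : ∀ j, 0 < Complex.normSq (v j) := fun j => Complex.normSq_pos.mpr (hv j)
  simp only [conjTranspose_mul_diagonal_mul_eq_iff]
  constructor
  · rintro ⟨h, hpos, hh⟩ i j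
    have hij : h i * S i * normSq (v j) = h j * S j * normSq (v i) := by
      have h1 := hh i j
      have h2 := hh j j
      have h3 : (h i : ℂ) * u i * star (v j) = h j * u j * star (v i) := by
        apply mul_right_cancel₀ (hv j)
        linear_combination star (v j) * h1 - star (v i) * h2
      have h4 : c * ((h i * S i * normSq (v j) : ℝ) : ℂ) =
          c * ((h j * S j * normSq (v i) : ℝ) : ℂ) := by
        push_cast
        rw [← hN, ← hN]
        linear_combination v i * v j * h3 - h i * star (v j) * v j * huv i +
          h j * star (v i) * v i * huv j
      exact_mod_cast mul_left_cancel₀ hc h4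
    have h5 : 0 < (S i * S j) * (h i * normSq (v j) * (h j * normSq (v i))) := by
      have : (S i * S j) * (h i * normSq (v j) * (h j * normSq (v i))) =
          (h i * S i * normSq (v j)) ^ 2 := by
        linear_combination -(h i * S i * normSq (v j)) * hij
      rw [this]
      have := hpos i; have := hNpos j; have := hS i
      positivity
    refine pos_of_mul_pos_left h5 ?_
    have := hpos i; have := hNpos j; have := hpos j; have := hNpos i
    positivity
  · intro hpos
    obtain ⟨j₀⟩ := ‹Nonempty ι›
    -- After absorbing the common sign into `c`, all values of `S` are positive.
    wlog hj₀ : 0 < S j₀ generalizing c S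
    · refine this (-c) (neg_ne_zero.mpr hc) (fun j => -S j) (fun j => neg_ne_zero.mpr (hS j)) ?_ ?_ ?_
      · intro j; rw [huv]; push_cast; ring
      · intro i j; simpa using hpos i j
      · exact neg_pos.mpr (lt_of_le_of_ne (not_lt.mp hj₀) (hS j₀))
    have hSpos : ∀ j, 0 < S j := fun j => pos_of_mul_pos_right (hpos j₀ j) hj₀.le
    set s : ℝ := ∑ k, S k with hs
    have hspos : 0 < s := Finset.sum_pos (fun j _ => hSpos j) ⟨j₀, Finset.mem_univ _⟩
    have hcs : ∑ k, u k * v k = c * s := by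
      rw [hs, ofReal_sum, Finset.mul_sum]
      exact Finset.sum_congr rfl fun k _ => huv k
    have hrel : c + star c + star c * c * s = 0 := by
      rw [hcs] at hdet
      have h1 := conj_mul_self_of_norm_eq_one hdet
      simp only [star_add, star_one, star_mul', Complex.star_def, conj_ofReal] at h1 ⊢
      apply mul_left_cancel₀ (ofReal_ne_zero.mpr hspos.ne')
      linear_combination h1
    have hu : ∀ j, ((normSq (v j) / S j : ℝ) : ℂ) * u j = c * star (v j) := by
      intro j
      have : (S j : ℂ) ≠ 0 := ofReal_ne_zero.mpr (hS j)
      push_cast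
      rw [← hN]
      field_simp
      linear_combination star (v j) * huv j
    have hu' : ∀ j, star (u j) * ((normSq (v j) / S j : ℝ) : ℂ) = star c * v j := by
      intro j
      have := congrArg star (hu j)
      simpa [mul_comm] using this
    have hT : ∑ k, ((normSq (v k) / S k : ℝ) : ℂ) * (star (u k) * u k) = star c * c * s := by
      rw [hs, ofReal_sum, Finset.mul_sum]
      refine Finset.sum_congr rfl fun k _ => ?_
      linear_combination u k * hu' k + star c * huv k
    refine ⟨fun j => normSq (v j) / S j, fun j => div_pos (hNpos j) (hSpos j), fun i j => ?_⟩
    rw [hT]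
    linear_combination v j * hu i + star (v i) * hu' j + star (v i) * v j * hrel

/-- **Beukers–Heckman unitarity criterion.**  A hypergeometric pair with
parameters `a_j = exp(2πi α_j)`, `b_j = exp(2πi β_j)` is simultaneously
conjugate into the unitary group iff the exponents interlace. -/
theorem hypergeometric_unitary_iff_interlacing
    (n : ℕ) (hn : 1 ≤ n) (α β : Fin n → ℝ)
    (hαmono : StrictMono α) (hβmono : StrictMono β)
    (hα0 : ∀ i, 0 ≤ α i) (hα1 : ∀ i, α i < 1)
    (hβ0 : ∀ i, 0 ≤ β i) (hβ1 : ∀ i, β i < 1)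
    (hαβ : ∀ j k, α j ≠ β k)
    (a b : Fin n → ℂ)
    (ha : ∀ j, a j = Complex.exp (2 * Real.pi * Complex.I * (α j : ℂ)))
    (hb : ∀ j, b j = Complex.exp (2 * Real.pi * Complex.I * (β j : ℂ)))
    (A B : Matrix (Fin n) (Fin n) ℂ)
    (hAdet : IsUnit A.det) (hBdet : IsUnit B.det)
    (hAchar : A.charpoly = ∏ j, (X - C (a j)))
    (hBchar : B.charpoly = ∏ j, (X - C (b j)))
    (hpseudo : (A⁻¹ * B - 1).rank = 1) :
    (∃ M : GL (Fin n) ℂ,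
        ((M : Matrix (Fin n) (Fin n) ℂ) * A * ((M⁻¹ : GL (Fin n) ℂ) : Matrix (Fin n) (Fin n) ℂ))
          ∈ Matrix.unitaryGroup (Fin n) ℂ ∧
        ((M : Matrix (Fin n) (Fin n) ℂ) * B * ((M⁻¹ : GL (Fin n) ℂ) : Matrix (Fin n) (Fin n) ℂ))
          ∈ Matrix.unitaryGroup (Fin n) ℂ) ↔
      (Interlaces α β ∨ Interlaces β α) := by
  have : Nonempty (Fin n) := ⟨⟨0, hn⟩⟩
  have hexp : ∀ x : ℝ, ‖exp (2 * Real.pi * I * (x : ℂ))‖ = 1 := fun x => by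
    rw [← norm_exp_ofReal_mul_I (2 * Real.pi * x)]
    congr 2; push_cast; ring
  have ha1 : ∀ j, ‖a j‖ = 1 := fun j => by rw [ha, hexp]
  have hb1 : ∀ j, ‖b j‖ = 1 := fun j => by rw [hb, hexp]
  have ha_inj : Function.Injective a := by
    intro i j hij
    by_contra hne
    have h := exp_two_pi_mul_I_sub_exp (α i) (α j)
    rw [← ha, ← ha, hij, sub_self] at h
    refine mul_ne_zero (by simp) (ofReal_ne_zero.mpr (Real.sin_pi_mul_ne_zero ?_ ?_
      (sub_ne_zero.mpr (hαmono.injective.ne hne)))) h.symm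
    · linarith [hα0 i, hα1 j]
    · linarith [hα1 i, hα0 j]
  obtain ⟨P, hP⟩ := A.exists_eq_conj_diagonal a ha_inj hAchar
  obtain ⟨u', v', huv'⟩ := (A⁻¹ * B - 1).exists_eq_vecMulVec_of_rank_le_one hpseudo.le
  obtain ⟨u, v, huv⟩ : ∃ u v : Fin n → ℂ, ((P⁻¹ : GL (Fin n) ℂ) : Matrix (Fin n) (Fin n) ℂ) *
      vecMulVec u' v' * (P : Matrix (Fin n) (Fin n) ℂ) = vecMulVec u v :=
    ⟨_, _, by rw [mul_vecMulVec, vecMulVec_mul]⟩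
  have hP1 : (P : Matrix (Fin n) (Fin n) ℂ) *
      ((P⁻¹ : GL (Fin n) ℂ) : Matrix (Fin n) (Fin n) ℂ) = 1 := P.mul_inv
  have hB : B = (P : Matrix (Fin n) (Fin n) ℂ) * (diagonal a * (1 + vecMulVec u v)) *
      ((P⁻¹ : GL (Fin n) ℂ) : Matrix (Fin n) (Fin n) ℂ) := by
    have h1 : B = A * (1 + vecMulVec u' v') := by
      rw [← huv', add_sub_cancel, mul_nonsing_inv_cancel_left _ _ hAdet]
    rw [h1, hP, ← huv]
    generalize vecMulVec u' v' = N
    generalize ((P⁻¹ : GL (Fin n) ℂ) : Matrix (Fin n) (Fin n) ℂ) = Q at *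
    generalize (P : Matrix (Fin n) (Fin n) ℂ) = P at *
    calc P * diagonal a * Q * (1 + N) = P * diagonal a * (Q + Q * N * 1) := by noncomm_ring
      _ = P * diagonal a * (Q + Q * N * (P * Q)) := by rw [hP1]
      _ = _ := by noncomm_ring
  have hchar : (diagonal a * (1 + vecMulVec u v)).charpoly = ∏ j, (X - C (b j)) := by
    rw [← hBchar, hB, coe_units_inv, charpoly_units_conj]
  obtain ⟨c, hc, huvc⟩ := exists_mul_residueRatio hαmono.injective hα0 hα1 a b
    (fun j => u j * v j) ha hb
    (prod_sub_roots_charpoly_diagonal_mul_one_add_vecMulVec a b u v hchar)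
  have hdet : ‖1 + ∑ k, u k * v k‖ = 1 := by
    have h1 := congrArg (fun p => ‖p.eval 0‖) hchar
    simp only [eval_charpoly, eval_prod, eval_sub, eval_X, eval_C, map_zero, zero_sub, norm_prod,
      norm_neg, hb1, Finset.prod_const_one, det_neg, det_mul, det_diagonal, norm_mul, norm_pow,
      norm_one, one_pow, one_mul, ha1, vecMulVec_eq Unit, det_one_add_replicateCol_mul_replicateRow]
      at h1
    rw [← h1, dotProduct]
    simp only [mul_comm]
  have hS : ∀ j, residueRatio α β j ≠ 0 := fun j =>
    div_ne_zero (prod_sin_ne_zero hα0 hα1 hβ0 hβ1 j _ fun k _ => hαβ j k)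
      (prod_sin_ne_zero hα0 hα1 hα0 hα1 j _ fun k hk h =>
        (Finset.mem_erase.mp hk).1 (hαmono.injective h).symm)
  rw [← interlaces_or_interlaces_iff_even hn hαmono hβmono hαβ]
  simp only [← residueRatio_mul_pos_iff hαmono hα0 hα1 hβ0 hβ1 hαβ]
  rw [← exists_pos_diagonal_invariant_iff u v c hc _ hS huvc hdet,
    ← exists_unitary_conj_diagonal_iff a ha_inj ha1]
  have hconj : ∀ (M : GL (Fin n) ℂ) (N : Matrix (Fin n) (Fin n) ℂ),
      (M : Matrix (Fin n) (Fin n) ℂ) * ((P : Matrix (Fin n) (Fin n) ℂ) * N *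
        ((P⁻¹ : GL (Fin n) ℂ) : Matrix (Fin n) (Fin n) ℂ)) *
        ((M⁻¹ : GL (Fin n) ℂ) : Matrix (Fin n) (Fin n) ℂ) =
      ((M * P : GL (Fin n) ℂ) : Matrix (Fin n) (Fin n) ℂ) * N *
        (((M * P)⁻¹ : GL (Fin n) ℂ) : Matrix (Fin n) (Fin n) ℂ) := by
    intro M N
    rw [_root_.mul_inv_rev, Units.val_mul, Units.val_mul]
    simp only [mul_assoc]
  rw [hB, hP]
  simp only [hconj]
  exact (Equiv.mulRight P).exists_congr_left.trans (by simp)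
end

section
/- (Rigidity of hypergeometric pairs.) Let a_1,…,a_n and b_1,…,b_n be nonzero complex numbers with a_j ≠ b_k for all j, k. Let (A_1, B_1) and (A_2, B_2) both be hypergeometric pairs with parameters (a_1,…,a_n; b_1,…,b_n), i.e. for i = 1, 2 the characteristic polynomial of A_i is ∏_j (t − a_j), the characteristic polynomial of B_i is ∏_j (t − b_j), and A_i⁻¹B_i is a pseudoreflection. Then there exists M ∈ GL_n(ℂ) such that A_2 = M·A_1·M⁻¹ and B_2 = M·B_1·M⁻¹. -/
open Matrix Polynomial

/-- A matrix of rank one is an outer product of two vectors. -/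
theorem Matrix.exists_eq_vecMulVec_of_rank_eq_one {F : Type*} [Field F] {m n : Type*}
    [Fintype m] [Fintype n] {R : Matrix m n F} (hR : R.rank = 1) :
    ∃ u v, R = vecMulVec u v := by
  classical
  obtain ⟨⟨u, hu⟩, -, h⟩ := finrank_eq_one_iff'.mp hR
  choose v hv using fun j => h ⟨R *ᵥ Pi.single j 1, LinearMap.mem_range_self R.mulVecLin _⟩
  refine ⟨u, v, ?_⟩
  ext i j
  have := congrFun (congrArg Subtype.val (hv j)) i
  simp at this
  simp [vecMulVec_apply, ← this, mul_comm]

section RankOneUpdate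

variable {F : Type*} [Field F] {n : ℕ} {A B : Matrix (Fin n) (Fin n) F} {u v : Fin n → F}

/-- The Krylov matrix, with columns `w, A w, A² w, …`. -/
def krylov (A : Matrix (Fin n) (Fin n) F) (w : Fin n → F) : Matrix (Fin n) (Fin n) F :=
  of fun i j => (A ^ (j : ℕ) *ᵥ w) i

/-- The companion matrix of the monic polynomial `p` of degree `n`. -/
def companion (n : ℕ) (p : F[X]) : Matrix (Fin n) (Fin n) F :=
  of fun i j => if (j : ℕ) + 1 < n then (if (i : ℕ) = j + 1 then 1 else 0) else -p.coeff i

/-- As long as the iterates of `x` under `A` are killed by `v`, they agree with those under the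
rank-one update `A + u vᵀ`. -/
theorem pow_mulVec_eq_of_dotProduct_eq_zero (hB : B = A + vecMulVec u v) {x : Fin n → F} {m : ℕ}
    (hx : ∀ j < m, v ⬝ᵥ (A ^ j *ᵥ x) = 0) : ∀ j ≤ m, B ^ j *ᵥ x = A ^ j *ᵥ x := by
  intro j
  induction j with
  | zero => simp
  | succ j ih =>
    intro hj
    rw [pow_succ', ← mulVec_mulVec, ih (by omega), hB, add_mulVec, vecMulVec_mulVec,
      hx j (by omega), pow_succ', mulVec_mulVec]
    simp

theorem aeval_mulVec_eq_sum {p : F[X]} {m : ℕ} (hp : p.natDegree < m)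
    (A : Matrix (Fin n) (Fin n) F) (x : Fin n → F) :
    aeval A p *ᵥ x = ∑ j ∈ Finset.range m, p.coeff j • (A ^ j *ᵥ x) := by
  simp [aeval_eq_sum_range' hp, Matrix.sum_mulVec, smul_mulVec]

/-- If the characteristic polynomials of `A` and `A + u vᵀ` are coprime, then the pair `(A, v)` is
observable. -/
theorem eq_zero_of_dotProduct_pow_mulVec_eq_zero (hB : B = A + vecMulVec u v)
    (hAB : IsCoprime A.charpoly B.charpoly) {x : Fin n → F}
    (hx : ∀ j < n, v ⬝ᵥ (A ^ j *ᵥ x) = 0) : x = 0 := by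
  obtain ⟨p, q, hpq⟩ := hAB
  have hpow := pow_mulVec_eq_of_dotProduct_eq_zero hB hx
  have hBA : aeval B A.charpoly *ᵥ x = 0 := by
    have hdeg : A.charpoly.natDegree < n + 1 := by simp
    rw [aeval_mulVec_eq_sum hdeg, Finset.sum_congr rfl fun j hj => by
      rw [hpow j (by simpa [Nat.lt_succ_iff] using hj)], ← aeval_mulVec_eq_sum hdeg,
      aeval_self_charpoly, zero_mulVec]
  have h := congrArg (fun r => aeval B r *ᵥ x) hpq
  simpa [add_mulVec, ← mulVec_mulVec, aeval_self_charpoly, hBA] using h.symm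

/-- Both `A` and its rank-one update share a Krylov matrix, which is invertible. -/
theorem exists_krylov_eq (hB : B = A + vecMulVec u v)
    (hAB : IsCoprime A.charpoly B.charpoly) :
    ∃ w, krylov B w = krylov A w ∧ IsUnit (krylov A w) := by
  let O : Matrix (Fin n) (Fin n) F := of fun i => v ᵥ* A ^ (n - 1 - (i : ℕ))
  have hO (i : Fin n) (x : Fin n → F) : (O *ᵥ x) i = v ⬝ᵥ (A ^ (n - 1 - (i : ℕ)) *ᵥ x) := by
    rw [dotProduct_mulVec]; rfl
  have hinj : Function.Injective O.mulVec := by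
    rw [← coe_mulVecLin, injective_iff_map_eq_zero]
    intro x hx
    refine eq_zero_of_dotProduct_pow_mulVec_eq_zero hB hAB fun j hj => ?_
    have h := congrFun hx ⟨n - 1 - j, by omega⟩
    rw [mulVecLin_apply, hO] at h
    simpa [show n - 1 - (n - 1 - j) = j by omega] using h
  have hOunit := mulVec_injective_iff_isUnit.mp hinj
  obtain ⟨w, hw⟩ := mulVec_surjective_iff_isUnit.mpr hOunit
    (fun i => if (i : ℕ) = 0 then 1 else 0)
  have hvw (j : ℕ) (hj : j < n) : v ⬝ᵥ (A ^ j *ᵥ w) = if j = n - 1 then 1 else 0 := by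
    have h := congrFun hw ⟨n - 1 - j, by omega⟩
    rw [hO] at h
    simp only [show n - 1 - (n - 1 - j) = j by omega] at h
    rw [h]
    exact if_congr (by omega) rfl rfl
  refine ⟨w, ?_, ?_⟩
  · ext i j
    refine congrFun (pow_mulVec_eq_of_dotProduct_eq_zero (m := n - 1) hB (fun k hk => ?_) j
      (by omega)) i
    rw [hvw k (by omega), if_neg (by omega)]
  · have hentry (i j : Fin n) :
        (O * krylov A w) i j = v ⬝ᵥ (A ^ (n - 1 - (i : ℕ) + j) *ᵥ w) := by
      rw [pow_add, ← mulVec_mulVec, ← hO]; rfl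
    have htri : (O * krylov A w).BlockTriangular id := fun i j (hij : j < i) => by
      rw [hentry, hvw _ (by omega), if_neg (by omega)]
    have hdet : (O * krylov A w).det = 1 := by
      rw [det_of_isUpperTriangular htri]
      exact Finset.prod_eq_one fun i _ => by rw [hentry, hvw _ (by omega), if_pos (by omega)]
    rw [isUnit_iff_isUnit_det]
    rw [det_mul] at hdet
    exact .of_mul_eq_one_right _ hdet

/-- Multiplication by `A` acts on the Krylov columns through the companion matrix of its
characteristic polynomial. -/
theorem mul_krylov (A : Matrix (Fin n) (Fin n) F) (w : Fin n → F) :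
    A * krylov A w = krylov A w * companion n A.charpoly := by
  ext i j
  have hl : (A * krylov A w) i j = (A ^ ((j : ℕ) + 1) *ᵥ w) i := by
    rw [pow_succ', ← mulVec_mulVec]; rfl
  rw [hl, mul_apply]
  by_cases hj : (j : ℕ) + 1 < n
  · rw [Finset.sum_eq_single ⟨j + 1, hj⟩]
    · simp [krylov, companion, hj]
    · intro k _ hk
      have : (k : ℕ) ≠ j + 1 := fun h => hk (Fin.ext h)
      simp [companion, hj, this]
    · simp
  · have hn : (j : ℕ) + 1 = n := by omega
    have h := aeval_mulVec_eq_sum (p := A.charpoly) (m := n + 1) (by simp) A w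
    have hlead : A.charpoly.coeff n = 1 := by
      simpa [Monic, leadingCoeff] using A.charpoly_monic
    rw [aeval_self_charpoly, zero_mulVec, Finset.sum_range_succ, hlead, one_smul,
      Finset.sum_range] at h
    have h' := congrFun h i
    simp only [Pi.zero_apply, Pi.add_apply, Finset.sum_apply, Pi.smul_apply, smul_eq_mul] at h'
    rw [hn, eq_neg_of_add_eq_zero_right h'.symm, ← Finset.sum_neg_distrib]
    exact Finset.sum_congr rfl fun k _ => by simp [krylov, companion, hn, mul_comm]

/-- A pair of matrices with coprime characteristic polynomials, differing by a pseudoreflection,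
is simultaneously conjugate to a pair of companion matrices. -/
theorem exists_mul_eq_mul_companion (hA : IsUnit A.det) (hR : (A⁻¹ * B - 1).rank = 1)
    (hAB : IsCoprime A.charpoly B.charpoly) :
    ∃ K : GL (Fin n) F, A * K = K * companion n A.charpoly ∧
      B * K = K * companion n B.charpoly := by
  obtain ⟨u, v, huv⟩ := exists_eq_vecMulVec_of_rank_eq_one hR
  have hB : B = A + vecMulVec (A *ᵥ u) v := by
    rw [← mul_vecMulVec, ← huv, mul_sub, mul_nonsing_inv_cancel_left _ _ hA]
    simp
  obtain ⟨w, hw, K, hK⟩ := exists_krylov_eq hB hAB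
  refine ⟨K, ?_, ?_⟩ <;> rw [hK]
  · exact mul_krylov A w
  · rw [← hw]
    exact mul_krylov B w

end RankOneUpdate

/-- **Rigidity of hypergeometric pairs.**  Two hypergeometric pairs with the
same parameters are simultaneously conjugate. -/
theorem hypergeometric_pair_rigid
    (n : ℕ) (a b : Fin n → ℂ)
    (ha : ∀ j, a j ≠ 0) (hb : ∀ j, b j ≠ 0)
    (hab : ∀ j k, a j ≠ b k)
    (A₁ B₁ A₂ B₂ : Matrix (Fin n) (Fin n) ℂ)
    (hA₁det : IsUnit A₁.det) (hB₁det : IsUnit B₁.det)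
    (hA₂det : IsUnit A₂.det) (hB₂det : IsUnit B₂.det)
    (hA₁char : A₁.charpoly = ∏ j, (X - C (a j)))
    (hB₁char : B₁.charpoly = ∏ j, (X - C (b j)))
    (hA₂char : A₂.charpoly = ∏ j, (X - C (a j)))
    (hB₂char : B₂.charpoly = ∏ j, (X - C (b j)))
    (hpseudo₁ : (A₁⁻¹ * B₁ - 1).rank = 1)
    (hpseudo₂ : (A₂⁻¹ * B₂ - 1).rank = 1) :
    ∃ M : GL (Fin n) ℂ,
      A₂ = (M : Matrix (Fin n) (Fin n) ℂ) * A₁ * ((M⁻¹ : GL (Fin n) ℂ) : Matrix (Fin n) (Fin n) ℂ) ∧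
      B₂ = (M : Matrix (Fin n) (Fin n) ℂ) * B₁ * ((M⁻¹ : GL (Fin n) ℂ) : Matrix (Fin n) (Fin n) ℂ) := by
  have hcop : IsCoprime (∏ j, (X - C (a j))) (∏ j, (X - C (b j))) :=
    .prod_left fun j _ => .prod_right fun k _ =>
      isCoprime_X_sub_C_of_isUnit_sub (sub_ne_zero.mpr (hab j k)).isUnit
  obtain ⟨K₁, hAK₁, hBK₁⟩ :=
    exists_mul_eq_mul_companion hA₁det hpseudo₁ (by rwa [hA₁char, hB₁char])
  obtain ⟨K₂, hAK₂, hBK₂⟩ :=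
    exists_mul_eq_mul_companion hA₂det hpseudo₂ (by rwa [hA₂char, hB₂char])
  have hconj {S₁ S₂ D : Matrix (Fin n) (Fin n) ℂ} (h₁ : S₁ * K₁ = K₁ * D)
      (h₂ : S₂ * K₂ = K₂ * D) :
      S₂ = ((K₂ * K₁⁻¹ : GL (Fin n) ℂ) : Matrix (Fin n) (Fin n) ℂ) * S₁ *
        (((K₂ * K₁⁻¹)⁻¹ : GL (Fin n) ℂ) : Matrix (Fin n) (Fin n) ℂ) := by
    rw [← Units.eq_mul_inv_iff_mul_eq] at h₁ h₂
    rw [h₁, h₂, _root_.mul_inv_rev, inv_inv, Units.val_mul, Units.val_mul]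
    simp only [mul_assoc, Units.inv_mul_cancel_left]
  rw [hA₁char] at hAK₁
  rw [hB₁char] at hBK₁
  rw [hA₂char] at hAK₂
  rw [hB₂char] at hBK₂
  exact ⟨K₂ * K₁⁻¹, hconj hAK₁ hAK₂, hconj hBK₁ hBK₂⟩
end

section
/- Let a_1,…,a_n and b_1,…,b_n be nonzero complex numbers, and let A, B ∈ GL_n(ℂ) be matrices such that the characteristic polynomial of A is ∏_j (t − a_j), the characteristic polynomial of B is ∏_j (t − b_j), and A⁻¹B is a pseudoreflection. Then there is no ℂ-subspace W of ℂⁿ with 0 ≠ W ≠ ℂⁿ that is invariant under both A and B (i.e. A·W ⊆ W and B·W ⊆ W) if and only if a_j ≠ b_k for all j and k. -/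
open Matrix Polynomial

namespace Module.End

variable {K V : Type*} [Field K] [AddCommGroup V] [Module K V]

/-- A linear map preserving a submodule has an eigenvalue in common with any map that agrees with
it on that submodule. -/
theorem exists_common_eigenvalue_of_eqOn [IsAlgClosed K] [FiniteDimensional K V]
    {f g : End K V} {W : Submodule K V} (hW : W ≠ ⊥) (hf : ∀ v ∈ W, f v ∈ W)
    (hfg : ∀ v ∈ W, g v = f v) : ∃ μ, f.HasEigenvalue μ ∧ g.HasEigenvalue μ := by
  have : Nontrivial W := Submodule.nontrivial_iff_ne_bot.mpr hW
  obtain ⟨μ, hμ⟩ := exists_eigenvalue (f.restrict hf)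
  obtain ⟨⟨v, hv⟩, hvμ⟩ := hμ.exists_hasEigenvector
  have hv0 : v ≠ 0 := fun h => hvμ.2 (Subtype.ext h)
  have hfv : f v = μ • v := congrArg Subtype.val hvμ.apply_eq_smul
  exact ⟨μ, hasEigenvalue_of_hasEigenvector ⟨mem_eigenspace_iff.mpr hfv, hv0⟩,
    hasEigenvalue_of_hasEigenvector ⟨mem_eigenspace_iff.mpr ((hfg v hv).trans hfv), hv0⟩⟩

theorem hasEigenvalue_iff_range_ne_top [FiniteDimensional K V] {f : End K V} {μ : K} :
    f.HasEigenvalue μ ↔ LinearMap.range (f - algebraMap K (End K V) μ) ≠ ⊤ := by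
  rw [hasEigenvalue_iff, eigenspace_def, Ne, Ne, LinearMap.ker_eq_bot_iff_range_eq_top,
    Algebra.algebraMap_eq_smul_one]

/-- An eigenvalue of the map induced on a quotient is an eigenvalue. -/
theorem HasEigenvalue.of_mapQ [FiniteDimensional K V] {f : End K V} {W : Submodule K V}
    (hf : W ≤ W.comap f) {μ : K} (h : HasEigenvalue (W.mapQ W f hf) μ) : f.HasEigenvalue μ := by
  rw [hasEigenvalue_iff_range_ne_top] at h ⊢
  refine fun htop => h (LinearMap.range_eq_top.mpr fun y => ?_)
  obtain ⟨y, rfl⟩ := W.mkQ_surjective y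
  obtain ⟨x, rfl⟩ := LinearMap.range_eq_top.mp htop y
  exact ⟨W.mkQ x, by simp [algebraMap_end_apply]⟩

/-- Two endomorphisms whose difference has rank one have a common nonzero proper invariant subspace
if and only if they have a common eigenvalue. -/
theorem exists_common_invariant_iff_exists_common_eigenvalue [IsAlgClosed K]
    [FiniteDimensional K V] {f g : End K V}
    (h : Module.finrank K (LinearMap.range (g - f)) = 1) :
    (∃ W : Submodule K V, W ≠ ⊥ ∧ W ≠ ⊤ ∧ (∀ v ∈ W, f v ∈ W) ∧ (∀ v ∈ W, g v ∈ W)) ↔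
      ∃ μ, f.HasEigenvalue μ ∧ g.HasEigenvalue μ := by
  have hne : g ≠ f := by
    rintro rfl
    rw [sub_self, LinearMap.range_zero, finrank_bot] at h
    exact zero_ne_one h
  have hspan : ∀ w, g w ≠ f w → ∀ x, ∃ c : K, c • (g w - f w) = g x - f x := by
    intro w hw x
    obtain ⟨c, hc⟩ := exists_smul_eq_of_finrank_eq_one h
      (x := ⟨(g - f) w, w, rfl⟩)
      (fun h0 => hw (sub_eq_zero.mp (congrArg Subtype.val h0))) ⟨(g - f) x, x, rfl⟩
    exact ⟨c, congrArg Subtype.val hc⟩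
  constructor
  · rintro ⟨W, hbot, htop, hf, hg⟩
    by_cases hagree : ∀ v ∈ W, g v = f v
    · exact exists_common_eigenvalue_of_eqOn hbot hf hagree
    · push Not at hagree
      obtain ⟨w, hw, hwne⟩ := hagree
      have hsub : ∀ x, g x - f x ∈ W := by
        intro x
        obtain ⟨c, hc⟩ := hspan w hwne x
        exact hc ▸ W.smul_mem c (W.sub_mem (hg w hw) (hf w hw))
      have hQ : W.mapQ W g hg = W.mapQ W f hf := by
        ext x
        simpa [Submodule.Quotient.eq] using hsub x
      have : Nontrivial (V ⧸ W) := Submodule.Quotient.nontrivial_iff.mpr htop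
      obtain ⟨μ, hμ⟩ := exists_eigenvalue (W.mapQ W f hf)
      exact ⟨μ, hμ.of_mapQ, HasEigenvalue.of_mapQ hg (hQ ▸ hμ)⟩
  · rintro ⟨μ, hfμ, hgμ⟩
    obtain ⟨v, hv⟩ := hfμ.exists_hasEigenvector
    have hfv := hv.apply_eq_smul
    by_cases hgv : g v = f v
    · refine ⟨K ∙ v, by simpa using hv.2, fun htop => hne (LinearMap.ext fun x => ?_), ?_, ?_⟩
      · obtain ⟨c, rfl⟩ := Submodule.mem_span_singleton.mp (htop ▸ Submodule.mem_top : x ∈ K ∙ v)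
        simp [hgv]
      all_goals
        intro x hx
        obtain ⟨c, rfl⟩ := Submodule.mem_span_singleton.mp hx
        rw [map_smul]
      · exact Submodule.smul_mem _ _ (hfv ▸ Submodule.smul_mem _ _
          (Submodule.mem_span_singleton_self v))
      · exact Submodule.smul_mem _ _ (hgv ▸ hfv ▸ Submodule.smul_mem _ _
          (Submodule.mem_span_singleton_self v))
    · -- Every vector is a multiple of `v` plus an element of `ker (g - f)`, and `f - μ` kills `v`,
      -- so `range (f - μ) ≤ range (g - μ)`.
      have hrange : ∀ x, f x - μ • x ∈ LinearMap.range (g - algebraMap K (End K V) μ) := by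
        intro x
        obtain ⟨c, hc⟩ := hspan v hgv x
        refine ⟨x - c • v, ?_⟩
        rw [hfv, smul_sub] at hc
        simp only [LinearMap.sub_apply, algebraMap_end_apply, map_sub, map_smul, smul_sub]
        rw [hc]
        abel
      refine ⟨LinearMap.range (g - algebraMap K (End K V) μ), fun hbot => hne ?_,
        hasEigenvalue_iff_range_ne_top.mp hgμ, fun x hx => ?_, fun x hx => ?_⟩
      · ext x
        have h1 := hrange x
        have h2 : g x - μ • x ∈ LinearMap.range (g - algebraMap K (End K V) μ) := ⟨x, rfl⟩
        rw [hbot, Submodule.mem_bot, sub_eq_zero] at h1 h2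
        rw [h1, h2]
      · simpa using Submodule.add_mem _ (hrange x) (Submodule.smul_mem _ μ hx)
      · have h2 : g x - μ • x ∈ LinearMap.range (g - algebraMap K (End K V) μ) := ⟨x, rfl⟩
        simpa using Submodule.add_mem _ h2 (Submodule.smul_mem _ μ hx)

end Module.End

theorem Matrix.hasEigenvalue_toLin'_iff_of_charpoly_eq_prod {K ι κ : Type*} [Field K]
    [Fintype ι] [DecidableEq ι] [Fintype κ] {A : Matrix ι ι K} {a : κ → K}
    (hA : A.charpoly = ∏ j, (X - C (a j))) {μ : K} :
    Module.End.HasEigenvalue (Matrix.toLin' A) μ ↔ ∃ j, a j = μ := by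
  rw [Module.End.hasEigenvalue_iff_isRoot_charpoly, Matrix.charpoly_toLin', hA, IsRoot.def,
    eval_prod, Finset.prod_eq_zero_iff]
  simp [sub_eq_zero, eq_comm]

/-- **Irreducibility criterion for hypergeometric pairs** (Beukers–Heckman):
a hypergeometric pair has no common nonzero proper invariant subspace iff
`a_j ≠ b_k` for all `j, k`. -/
theorem hypergeometric_irreducible_iff
    (n : ℕ) (a b : Fin n → ℂ)
    (ha : ∀ j, a j ≠ 0) (hb : ∀ j, b j ≠ 0)
    (A B : Matrix (Fin n) (Fin n) ℂ)
    (hAdet : IsUnit A.det) (hBdet : IsUnit B.det)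
    (hAchar : A.charpoly = ∏ j, (X - C (a j)))
    (hBchar : B.charpoly = ∏ j, (X - C (b j)))
    (hpseudo : (A⁻¹ * B - 1).rank = 1) :
    (¬ ∃ W : Submodule ℂ (Fin n → ℂ), W ≠ ⊥ ∧ W ≠ ⊤ ∧
        (∀ v ∈ W, A.mulVec v ∈ W) ∧ (∀ v ∈ W, B.mulVec v ∈ W)) ↔
      ∀ j k, a j ≠ b k := by
  have hrank : Module.finrank ℂ (LinearMap.range (Matrix.toLin' B - Matrix.toLin' A)) = 1 := by
    rw [← map_sub, Matrix.toLin'_apply', ← Matrix.rank, ← hpseudo,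
      ← Matrix.rank_mul_eq_right_of_isUnit_det A (A⁻¹ * B - 1) hAdet, mul_sub, mul_one,
      Matrix.mul_nonsing_inv_cancel_left _ _ hAdet]
  have key := Module.End.exists_common_invariant_iff_exists_common_eigenvalue hrank
  simp only [Matrix.toLin'_apply, Matrix.hasEigenvalue_toLin'_iff_of_charpoly_eq_prod hAchar,
    Matrix.hasEigenvalue_toLin'_iff_of_charpoly_eq_prod hBchar] at key
  rw [key]
  constructor
  · exact fun h j k hjk => h ⟨a j, ⟨j, rfl⟩, k, hjk.symm⟩
  · rintro h ⟨μ, ⟨j, hj⟩, k, hk⟩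
    exact h j k (hj.trans hk.symm)
end

section
/- (Levelt's construction.) Let P and Q be monic polynomials of degree n over ℂ with P ≠ Q and with nonzero constant terms, and let A and B be the companion matrices of P and Q respectively. Then A and B are invertible and A⁻¹·B is a pseudoreflection, i.e. rank(A⁻¹B − I) = 1. In particular, for any nonzero complex numbers a_1,…,a_n, b_1,…,b_n with a_j ≠ b_k for all j, k, taking P = ∏_j (t − a_j) and Q = ∏_j (t − b_j) produces a pair (A, B) whose characteristic polynomials are P and Q and for which A⁻¹B is a pseudoreflection. -/
open Matrix Polynomial

/-- The companion matrix of a monic polynomial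
`t^n + c_{n-1} t^{n-1} + ⋯ + c_1 t + c_0`: ones on the subdiagonal, last
column `(-c_0, …, -c_{n-1})ᵀ`, zeros elsewhere. -/
def companionMatrix (n : ℕ) (p : Polynomial ℂ) : Matrix (Fin n) (Fin n) ℂ :=
  fun i j =>
    (if (j : ℕ) + 1 = (i : ℕ) then 1 else 0) +
      (if (j : ℕ) = n - 1 then -p.coeff (i : ℕ) else 0)

theorem charpoly_companionMatrix {p : Polynomial ℂ} (hp : p.Monic) :
    (companionMatrix p.natDegree p).charpoly = p := by
  let pb := AdjoinRoot.powerBasis hp.ne_zero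
  have hmin : minpoly ℂ pb.gen = p := AdjoinRoot.minpoly_powerBasis_gen_of_monic hp
  have hmul : Algebra.leftMulMatrix pb.basis pb.gen = companionMatrix p.natDegree p := by
    rw [pb.leftMulMatrix, pb.minpolyGen_eq, hmin]
    ext (i : Fin p.natDegree) (j : Fin p.natDegree)
    change (if (j : ℕ) + 1 = p.natDegree then -p.coeff i
      else if (i : ℕ) = j + 1 then 1 else 0) = _
    unfold companionMatrix
    have hi := i.isLt
    have hj := j.isLt
    split_ifs <;> first | omega | simp
  exact (congrArg charpoly hmul).symm.trans ((charpoly_leftMulMatrix pb).trans hmin)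

theorem isUnit_det_companionMatrix {p : Polynomial ℂ} (hp : p.Monic) (h0 : p.coeff 0 ≠ 0) :
    IsUnit (companionMatrix p.natDegree p).det := by
  rw [det_eq_sign_charpoly_coeff, charpoly_companionMatrix hp]
  exact ((isUnit_one.neg).pow _).mul h0.isUnit

theorem companionMatrix_sub_companionMatrix (n : ℕ) (p q : Polynomial ℂ) :
    companionMatrix n q - companionMatrix n p =
      vecMulVec (fun i : Fin n => (p - q).coeff i)
        (fun j : Fin n => if (j : ℕ) = n - 1 then 1 else 0) := by
  ext i j
  simp only [companionMatrix, Matrix.sub_apply, vecMulVec_apply, coeff_sub]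
  split_ifs <;> ring

theorem rank_companionMatrix_sub_companionMatrix {n : ℕ} {p q : Polynomial ℂ}
    (hp : p.Monic) (hq : q.Monic) (hpn : p.natDegree = n) (hqn : q.natDegree = n)
    (hpq : p ≠ q) : (companionMatrix n q - companionMatrix n p).rank = 1 := by
  have hcoeff : ∃ i < n, (p - q).coeff i ≠ 0 := by
    by_contra! h
    refine hpq (Polynomial.ext fun i => ?_)
    rcases lt_trichotomy i n with hi | rfl | hi
    · simpa [sub_eq_zero] using h i hi
    · rw [← hpn, hp.coeff_natDegree, hpn, ← hqn, hq.coeff_natDegree]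
    · rw [coeff_eq_zero_of_natDegree_lt (hpn ▸ hi), coeff_eq_zero_of_natDegree_lt (hqn ▸ hi)]
  obtain ⟨i, hi, hne⟩ := hcoeff
  rw [companionMatrix_sub_companionMatrix]
  refine le_antisymm (rank_vecMulVec_le _ _) (Nat.one_le_iff_ne_zero.2 fun h => ?_)
  rw [rank, Submodule.finrank_eq_zero, LinearMap.range_eq_bot] at h
  have hcol := congrFun (LinearMap.congr_fun h (Pi.single ⟨n - 1, by omega⟩ 1)) ⟨i, hi⟩
  exact hne (by simpa [vecMulVec_apply] using hcol)

/-- **Levelt's construction.**  If `P ≠ Q` are monic of degree `n` with nonzero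
constant terms, their companion matrices `A`, `B` are invertible, have
characteristic polynomials `P` and `Q`, and `A⁻¹ * B` is a pseudoreflection. -/
theorem levelt_construction
    (n : ℕ) (P Q : Polynomial ℂ)
    (hPmonic : P.Monic) (hQmonic : Q.Monic)
    (hPdeg : P.natDegree = n) (hQdeg : Q.natDegree = n)
    (hPQ : P ≠ Q)
    (hP0 : P.coeff 0 ≠ 0) (hQ0 : Q.coeff 0 ≠ 0)
    (A B : Matrix (Fin n) (Fin n) ℂ)
    (hA : A = companionMatrix n P) (hB : B = companionMatrix n Q) :
    IsUnit A.det ∧ IsUnit B.det ∧ A.charpoly = P ∧ B.charpoly = Q ∧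
      (A⁻¹ * B - 1).rank = 1 := by
  subst hA hB
  have hAdet : IsUnit (companionMatrix n P).det :=
    hPdeg ▸ isUnit_det_companionMatrix hPmonic hP0
  refine ⟨hAdet, hQdeg ▸ isUnit_det_companionMatrix hQmonic hQ0,
    hPdeg ▸ charpoly_companionMatrix hPmonic, hQdeg ▸ charpoly_companionMatrix hQmonic, ?_⟩
  rw [← nonsing_inv_mul _ hAdet, ← Matrix.mul_sub,
    rank_mul_eq_right_of_isUnit_det _ _ (isUnit_nonsing_inv_det _ hAdet)]
  exact rank_companionMatrix_sub_companionMatrix hPmonic hQmonic hPdeg hQdeg hPQ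
end
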